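/- Let N = ℝ⟨OT⟩ be the vector space spanned by forests of planar rooted trees with nodes colored by a set C, with concatenation product and left grafting operation [·]. Then the ordered Grossman–Larson product ω ∘ ω′ = B⁻(ω[B⁺(ω′)]) (add a root to ω′, graft ω onto the result, remove the root) is associative with unit the empty forest, and satisfies n[n′[n″]] = (n ∘ n′)[n″] for all n, n′, n″ ∈ N. -/

import Mathlib

noncomputable section

mutual
/-- A planar (ordered) rooted tree with nodes colored by `C`. -/
inductive PTree (C : Type) : Type
  | node : C → PForest C → PTree C
/-- A planar forest: an ordered list of planar rooted trees. -/
inductive PForest (C : Type) : Type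
  | nil : PForest C
  | cons : PTree C → PForest C → PForest C
end

/-- Concatenation of forests. -/
def PForest.app {C : Type} : PForest C → PForest C → PForest C
  | .nil, w => w
  | .cons t u, w => .cons t (PForest.app u w)

/-- The free `ℝ`-vector space `N = ℝ⟨OT⟩` on planar forests. -/
abbrev NA (C : Type) : Type := PForest C →₀ ℝ

/-- The concatenation product on `N`, as a bilinear map. -/
def concL {C : Type} : NA C →ₗ[ℝ] NA C →ₗ[ℝ] NA C :=
  Finsupp.lsum ℝ fun w =>
    LinearMap.toSpanSingleton ℝ (NA C →ₗ[ℝ] NA C)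
      (Finsupp.lsum ℝ fun w' =>
        LinearMap.toSpanSingleton ℝ (NA C) (Finsupp.single (w.app w') 1))

/-- `B⁺_c` on a single forest: attach the branches to a new root colored `c`,
giving a one-tree forest. -/
def bplusF {C : Type} (c : C) (ω : PForest C) : PForest C :=
  PForest.cons (PTree.node c ω) PForest.nil

/-- `B⁻` on a basis forest: remove the root of a single tree, otherwise `0`. -/
def bminusF {C : Type} : PForest C → NA C
  | .cons (.node _ φ) .nil => Finsupp.single φ 1
  | _ => 0

/-- `B⁻` extended linearly. -/
def Bm {C : Type} : NA C →ₗ[ℝ] NA C :=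
  Finsupp.lsum ℝ fun w => LinearMap.toSpanSingleton ℝ (NA C) (bminusF w)

namespace PForest

/-- The number of trees of a forest. -/
def length {C : Type} : PForest C → ℕ
  | .nil => 0
  | .cons _ u => u.length + 1

theorem length_app {C : Type} : ∀ u w : PForest C, (u.app w).length = u.length + w.length
  | .nil, w => by simp [app, length]
  | .cons t u, w => by simp [app, length, length_app u w]; omega

theorem app_nil {C : Type} : ∀ u : PForest C, u.app .nil = u
  | .nil => rfl
  | .cons t u => by rw [app, app_nil u]

end PForest

theorem concL_single {C : Type} (u w : PForest C) :
    concL (Finsupp.single u 1) (Finsupp.single w 1) = Finsupp.single (u.app w) 1 := by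
  simp [concL]

/-- Adding a root, extended linearly. -/
abbrev Bp {C : Type} (c : C) : NA C →ₗ[ℝ] NA C := Finsupp.lmapDomain ℝ ℝ (bplusF c)

theorem Bm_Bp {C : Type} (c : C) (a : NA C) : Bm (Bp c a) = a := by
  have h : Bm ∘ₗ Bp c = LinearMap.id := by
    ext1 w
    ext1
    simp [Bm, bplusF, bminusF]
  exact LinearMap.congr_fun h a

/-- The combinations of forests with `n` trees. -/
abbrev NA.homogeneous (C : Type) (n : ℕ) : Submodule ℝ (NA C) :=
  Finsupp.supported ℝ ℝ {w : PForest C | w.length = n}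

theorem NA.single_mem_homogeneous {C : Type} {n : ℕ} {w : PForest C} (hw : w.length = n) :
    Finsupp.single w 1 ∈ NA.homogeneous C n :=
  Finsupp.single_mem_supported ℝ 1 hw

theorem NA.homogeneous_le_iff {C : Type} {n : ℕ} {S : Submodule ℝ (NA C)} :
    NA.homogeneous C n ≤ S ↔ ∀ w : PForest C, w.length = n → Finsupp.single w 1 ∈ S := by
  rw [NA.homogeneous, Finsupp.supported_eq_span_single, Submodule.span_le, Set.image_subset_iff]
  rfl

theorem concL_mem_homogeneous {C : Type} {m n : ℕ} {a b : NA C}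
    (ha : a ∈ NA.homogeneous C m) (hb : b ∈ NA.homogeneous C n) :
    concL a b ∈ NA.homogeneous C (m + n) := by
  have h : NA.homogeneous C m ≤ (NA.homogeneous C (m + n)).comap (concL.flip b) := by
    refine NA.homogeneous_le_iff.2 fun u hu => ?_
    have h' : NA.homogeneous C n ≤
        (NA.homogeneous C (m + n)).comap (concL (Finsupp.single u 1)) := by
      refine NA.homogeneous_le_iff.2 fun w hw => ?_
      rw [Submodule.mem_comap, concL_single]
      exact NA.single_mem_homogeneous (by rw [PForest.length_app, hu, hw])
    exact h' hb
  exact h ha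

theorem Bp_mem_homogeneous {C : Type} (c : C) (a : NA C) : Bp c a ∈ NA.homogeneous C 1 := by
  induction a using Finsupp.induction_linear with
  | zero => simp
  | add a b ha hb => rw [map_add]; exact add_mem ha hb
  | single w r =>
    rw [Finsupp.lmapDomain_apply, Finsupp.mapDomain_single]
    exact Finsupp.single_mem_supported ℝ r rfl

/-- A tree, as a forest, as an element of `N`. -/
abbrev NA.tree {C : Type} (τ : PTree C) : NA C :=
  Finsupp.single (PForest.cons τ PForest.nil) 1

/-- The defining equations of left grafting. -/
structure IsLeftGrafting {C : Type} (gr : NA C →ₗ[ℝ] NA C →ₗ[ℝ] NA C) : Prop where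
  graft_node : ∀ (ω : PForest C) (c : C),
    gr (Finsupp.single ω 1) (Finsupp.single (bplusF c PForest.nil) 1) =
      Finsupp.single (bplusF c ω) 1
  nil_graft_single : ∀ ω : PForest C,
    gr (Finsupp.single PForest.nil 1) (Finsupp.single ω 1) = Finsupp.single ω 1
  tree_graft_app : ∀ (τ : PTree C) (ω ω' : PForest C),
    gr (NA.tree τ) (Finsupp.single (ω.app ω') 1) =
      concL (gr (NA.tree τ) (Finsupp.single ω 1)) (Finsupp.single ω' 1)
        + concL (Finsupp.single ω 1) (gr (NA.tree τ) (Finsupp.single ω' 1))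
  cons_graft_single : ∀ (τ : PTree C) (ω ω' : PForest C),
    gr (Finsupp.single (PForest.cons τ ω) 1) (Finsupp.single ω' 1) =
      gr (NA.tree τ) (gr (Finsupp.single ω 1) (Finsupp.single ω' 1))
        - gr (gr (NA.tree τ) (Finsupp.single ω 1)) (Finsupp.single ω' 1)

/-- The ordered Grossman–Larson product of a grafting operation, as a bilinear map. -/
def grossmanLarson {C : Type} (c : C) (gr : NA C →ₗ[ℝ] NA C →ₗ[ℝ] NA C) :
    NA C →ₗ[ℝ] NA C →ₗ[ℝ] NA C :=
  (gr.compl₂ (Bp c)).compr₂ Bm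

theorem grossmanLarson_apply {C : Type} (c : C) (gr : NA C →ₗ[ℝ] NA C →ₗ[ℝ] NA C) (a b : NA C) :
    grossmanLarson c gr a b = Bm (gr a (Bp c b)) := rfl

namespace IsLeftGrafting

variable {C : Type} {gr : NA C →ₗ[ℝ] NA C →ₗ[ℝ] NA C}

theorem nil_graft (hgr : IsLeftGrafting gr) (x : NA C) :
    gr (Finsupp.single PForest.nil 1) x = x := by
  have h : gr (Finsupp.single PForest.nil 1) = LinearMap.id := by
    ext1 w
    ext1
    simpa using hgr.nil_graft_single w
  exact LinearMap.congr_fun h x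

theorem graft_node' (hgr : IsLeftGrafting gr) (c : C) (a : NA C) :
    gr a (Finsupp.single (bplusF c PForest.nil) 1) = Bp c a := by
  have h : gr.flip (Finsupp.single (bplusF c PForest.nil) 1) = Bp c := by
    ext1 w
    ext1
    simpa using hgr.graft_node w c
  exact LinearMap.congr_fun h a

theorem concL_tree_graft (hgr : IsLeftGrafting gr) (τ : PTree C) (v x : NA C) :
    gr (concL (NA.tree τ) v) x = gr (NA.tree τ) (gr v x) - gr (gr (NA.tree τ) v) x := by
  have h : gr ∘ₗ concL (NA.tree τ) + gr ∘ₗ gr (NA.tree τ) = gr.compr₂ (gr (NA.tree τ)) := by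
    ext1 w
    ext1
    ext1 w'
    ext1
    simpa [concL_single, PForest.app] using eq_sub_iff_add_eq.1 (hgr.cons_graft_single τ w w')
  exact eq_sub_of_add_eq (LinearMap.congr_fun₂ h v x)

theorem tree_graft_Bp (hgr : IsLeftGrafting gr) (τ : PTree C) (c : C) (v : NA C) :
    gr (NA.tree τ) (Bp c v) = Bp c (concL (NA.tree τ) v + gr (NA.tree τ) v) := by
  have h := hgr.concL_tree_graft τ v (Finsupp.single (bplusF c PForest.nil) 1)
  simp only [hgr.graft_node'] at h
  rw [map_add, h, sub_add_cancel]

theorem tree_graft_nil (hgr : IsLeftGrafting gr) (τ : PTree C) :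
    gr (NA.tree τ) (Finsupp.single PForest.nil 1) = 0 := by
  have h := hgr.tree_graft_app τ PForest.nil PForest.nil
  have hl : concL (Finsupp.single (PForest.nil : PForest C) 1) = LinearMap.id := by
    ext1 w
    ext1
    simp [concL_single, PForest.app]
  have hr : concL.flip (Finsupp.single (PForest.nil : PForest C) 1) = LinearMap.id := by
    ext1 w
    ext1
    simp [concL_single, PForest.app_nil]
  rw [hl, ← LinearMap.flip_apply concL, hr] at h
  simpa [PForest.app] using h

theorem tree_graft_mem_homogeneous (hgr : IsLeftGrafting gr) (τ : PTree C) :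
    ∀ ω : PForest C, gr (NA.tree τ) (Finsupp.single ω 1) ∈ NA.homogeneous C ω.length
  | .nil => by rw [hgr.tree_graft_nil]; exact zero_mem _
  | .cons (.node c φ) u => by
    have hu := tree_graft_mem_homogeneous hgr τ u
    have happ : PForest.cons (PTree.node c φ) u = (bplusF c φ).app u := rfl
    have hB : (Finsupp.single (bplusF c φ) 1 : NA C) = Bp c (Finsupp.single φ 1) := by simp
    have hlen : ((bplusF c φ).app u).length = 1 + u.length := PForest.length_app _ _
    rw [happ, hgr.tree_graft_app, hlen, hB, hgr.tree_graft_Bp]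
    exact add_mem
      (concL_mem_homogeneous (Bp_mem_homogeneous c _) (NA.single_mem_homogeneous rfl))
      (concL_mem_homogeneous (Bp_mem_homogeneous c _) hu)

/-- Linear maps on `N` agree as soon as they satisfy the same recursion `τω ↦ (ω, τ[ω])`. -/
theorem hom_ext (hgr : IsLeftGrafting gr) {M : Type*} [AddCommMonoid M] [Module ℝ M]
    {f g : NA C →ₗ[ℝ] M}
    (nil : f (Finsupp.single PForest.nil 1) = g (Finsupp.single PForest.nil 1))
    (cons : ∀ (τ : PTree C) (ω : NA C), f ω = g ω →
      f (gr (NA.tree τ) ω) = g (gr (NA.tree τ) ω) →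
      f (concL (NA.tree τ) ω) = g (concL (NA.tree τ) ω)) :
    f = g := by
  have key : ∀ (n : ℕ), NA.homogeneous C n ≤ LinearMap.eqLocus f g := by
    intro n
    induction n with
    | zero =>
      refine NA.homogeneous_le_iff.2 fun w hw => ?_
      cases w with
      | nil => exact nil
      | cons t u => simp [PForest.length] at hw
    | succ n ih =>
      refine NA.homogeneous_le_iff.2 fun w hw => ?_
      cases w with
      | nil => simp [PForest.length] at hw
      | cons τ u =>
        obtain rfl : u.length = n := by simpa [PForest.length] using hw
        have h := cons τ (Finsupp.single u 1) (ih (NA.single_mem_homogeneous rfl))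
          (ih (hgr.tree_graft_mem_homogeneous τ u))
        rwa [concL_single] at h
  ext1 w
  ext1
  exact key w.length (NA.single_mem_homogeneous rfl)

theorem graft_Bp (hgr : IsLeftGrafting gr) (c : C) (a b : NA C) :
    gr a (Bp c b) = Bp c (grossmanLarson c gr a b) := by
  have h : gr.compl₂ (Bp c) = (grossmanLarson c gr).compr₂ (Bp c) := by
    refine hgr.hom_ext ?_ fun τ ω h₁ h₂ => LinearMap.ext fun b => ?_
    · refine LinearMap.ext fun b => ?_
      simp only [LinearMap.compl₂_apply, LinearMap.compr₂_apply, grossmanLarson_apply,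
        hgr.nil_graft, Bm_Bp]
    · replace h₁ := LinearMap.congr_fun h₁ b
      replace h₂ := LinearMap.congr_fun h₂ b
      simp only [LinearMap.compl₂_apply, LinearMap.compr₂_apply] at h₁ h₂ ⊢
      rw [grossmanLarson_apply, hgr.concL_tree_graft, h₁, h₂, hgr.tree_graft_Bp, ← map_sub, Bm_Bp]
  exact LinearMap.congr_fun₂ h a b

theorem grossmanLarson_concL_tree (hgr : IsLeftGrafting gr) (c : C) (τ : PTree C) (ω b : NA C) :
    grossmanLarson c gr (concL (NA.tree τ) ω) b =
      concL (NA.tree τ) (grossmanLarson c gr ω b) + gr (NA.tree τ) (grossmanLarson c gr ω b)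
        - grossmanLarson c gr (gr (NA.tree τ) ω) b := by
  rw [grossmanLarson_apply, hgr.concL_tree_graft, hgr.graft_Bp c ω, hgr.tree_graft_Bp,
    hgr.graft_Bp c (gr _ ω), ← map_sub, Bm_Bp]

theorem nil_grossmanLarson (hgr : IsLeftGrafting gr) (c : C) (a : NA C) :
    grossmanLarson c gr (Finsupp.single PForest.nil 1) a = a := by
  rw [grossmanLarson_apply, hgr.nil_graft, Bm_Bp]

theorem grossmanLarson_nil (hgr : IsLeftGrafting gr) (c : C) (a : NA C) :
    grossmanLarson c gr a (Finsupp.single PForest.nil 1) = a := by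
  rw [grossmanLarson_apply, Finsupp.lmapDomain_apply, Finsupp.mapDomain_single, hgr.graft_node',
    Bm_Bp]

theorem graft_graft (hgr : IsLeftGrafting gr) (c : C) (a b x : NA C) :
    gr a (gr b x) = gr (grossmanLarson c gr a b) x := by
  have h : gr.compl₂ (gr.flip x) = (grossmanLarson c gr).compr₂ (gr.flip x) := by
    refine hgr.hom_ext ?_ fun τ ω h₁ h₂ => LinearMap.ext fun b => ?_
    · refine LinearMap.ext fun b => ?_
      simp only [LinearMap.compl₂_apply, LinearMap.compr₂_apply, LinearMap.flip_apply,
        hgr.nil_graft, hgr.nil_grossmanLarson]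
    · replace h₁ := LinearMap.congr_fun h₁ b
      replace h₂ := LinearMap.congr_fun h₂ b
      simp only [LinearMap.compl₂_apply, LinearMap.compr₂_apply, LinearMap.flip_apply] at h₁ h₂ ⊢
      rw [hgr.concL_tree_graft, h₁, h₂, hgr.grossmanLarson_concL_tree]
      simp only [map_add, map_sub, LinearMap.add_apply, LinearMap.sub_apply, hgr.concL_tree_graft]
      abel
  exact LinearMap.congr_fun₂ h a b

theorem grossmanLarson_assoc (hgr : IsLeftGrafting gr) (c : C) (x y z : NA C) :
    grossmanLarson c gr (grossmanLarson c gr x y) z =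
      grossmanLarson c gr x (grossmanLarson c gr y z) := by
  rw [grossmanLarson_apply, ← hgr.graft_graft, hgr.graft_Bp c y z, ← grossmanLarson_apply]

end IsLeftGrafting

/-- Let `N = ℝ⟨OT⟩` with concatenation and left grafting `[·]` (the
bilinear operation `gr` determined by `ω[c] = B⁺_c(ω)`, `1[ω] = ω`,
`τ[ωω'] = τ[ω]ω' + ω(τ[ω'])` and `(τω)[ω'] = τ[ω[ω']] - (τ[ω])[ω']`).  Then the ordered
Grossman–Larson product `ω ∘ ω' = B⁻(ω[B⁺(ω')])` is associative with unit the empty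
forest, and satisfies `n[n'[n'']] = (n ∘ n')[n'']` for all `n, n', n'' ∈ N`. -/
theorem grossman_larson_product_associative
    (C : Type) (c₀ : C)
    (gr : NA C →ₗ[ℝ] NA C →ₗ[ℝ] NA C)
    -- `ω[c] = B⁺_c(ω)`
    (h1 : ∀ (ω : PForest C) (c : C),
      gr (Finsupp.single ω 1) (Finsupp.single (bplusF c PForest.nil) 1) =
        Finsupp.single (bplusF c ω) 1)
    -- `1[ω] = ω`
    (h2 : ∀ ω : PForest C,
      gr (Finsupp.single PForest.nil 1) (Finsupp.single ω 1) = Finsupp.single ω 1)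
    -- `τ[ωω'] = τ[ω]ω' + ω(τ[ω'])`
    (h3 : ∀ (τ : PTree C) (ω ω' : PForest C),
      gr (Finsupp.single (PForest.cons τ PForest.nil) 1)
          (Finsupp.single (ω.app ω') 1) =
        concL (gr (Finsupp.single (PForest.cons τ PForest.nil) 1)
            (Finsupp.single ω 1)) (Finsupp.single ω' 1)
          + concL (Finsupp.single ω 1)
              (gr (Finsupp.single (PForest.cons τ PForest.nil) 1)
                (Finsupp.single ω' 1)))
    -- `(τω)[ω'] = τ[ω[ω']] - (τ[ω])[ω']`
    (h4 : ∀ (τ : PTree C) (ω ω' : PForest C),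
      gr (Finsupp.single (PForest.cons τ ω) 1) (Finsupp.single ω' 1) =
        gr (Finsupp.single (PForest.cons τ PForest.nil) 1)
            (gr (Finsupp.single ω 1) (Finsupp.single ω' 1))
          - gr (gr (Finsupp.single (PForest.cons τ PForest.nil) 1)
              (Finsupp.single ω 1)) (Finsupp.single ω' 1)) :
    -- the ordered Grossman–Larson product `a ∘ b = B⁻(a[B⁺(b)])`
    ∀ gl : NA C → NA C → NA C,
      (∀ a b : NA C,
        gl a b = Bm (gr a ((Finsupp.lmapDomain ℝ ℝ (bplusF c₀)) b))) →
      -- associativity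
      (∀ a b c : NA C, gl (gl a b) c = gl a (gl b c)) ∧
      -- the empty forest is a two-sided unit
      (∀ a : NA C, gl (Finsupp.single PForest.nil 1) a = a ∧
        gl a (Finsupp.single PForest.nil 1) = a) ∧
      -- `n[n'[n'']] = (n ∘ n')[n'']`
      (∀ a b c : NA C, gr a (gr b c) = gr (gl a b) c) := by
  intro gl hgl
  have hgr : IsLeftGrafting gr := ⟨h1, h2, h3, h4⟩
  obtain rfl : gl = fun a b => grossmanLarson c₀ gr a b := by
    funext a b
    rw [hgl, grossmanLarson_apply]
  exact ⟨hgr.grossmanLarson_assoc c₀,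
    fun a => ⟨hgr.nil_grossmanLarson c₀ a, hgr.grossmanLarson_nil c₀ a⟩,
    hgr.graft_graft c₀⟩

end
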